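/- For |x| < 1 and y ∈ S^n, the normalization identity ∫_{S^n} (1-|x|²)/|y-x|^{n+1} dσ^n(y) = 1 holds, i.e. the Poisson kernel for the unit ball integrates to 1 over the sphere. -/

import Mathlib

open MeasureTheory

namespace PoissonKernel

open Set Metric Real Module
open scoped RealInnerProductSpace

section Polar

variable {E : Type*} [NormedAddCommGroup E] [NormedSpace ℝ E] [FiniteDimensional ℝ E]
  [MeasurableSpace E] [BorelSpace E] (μ : Measure E) [μ.IsAddHaarMeasure]

/-- Integration in polar coordinates. -/
theorem lintegral_eq_lintegral_toSphere [Nontrivial E] {f : E → ENNReal} (hf : Measurable f) :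
    ∫⁻ z, f z ∂μ = ∫⁻ y : sphere (0 : E) 1, (∫⁻ r in Ioi (0 : ℝ),
      ENNReal.ofReal (r ^ (finrank ℝ E - 1)) * f (r • (y : E))) ∂μ.toSphere := by
  have hpow : Measurable fun r : Ioi (0 : ℝ) ↦ ENNReal.ofReal ((r : ℝ) ^ (finrank ℝ E - 1)) := by
    fun_prop
  have hg : Measurable fun p : sphere (0 : E) 1 × Ioi (0 : ℝ) ↦ f ((p.2 : ℝ) • (p.1 : E)) := by
    fun_prop
  calc ∫⁻ z, f z ∂μ = ∫⁻ z : ({0}ᶜ : Set E), f z ∂μ.comap (↑) := by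
        rw [lintegral_subtype_comap (measurableSet_singleton _).compl f,
          restrict_compl_singleton]
    _ = ∫⁻ p, f ((p.2 : ℝ) • (p.1 : E))
          ∂μ.toSphere.prod (.volumeIoiPow (finrank ℝ E - 1)) := by
        rw [← μ.measurePreserving_homeomorphUnitSphereProd.lintegral_comp hg]
        refine lintegral_congr fun z ↦ ?_
        have : (z : E) ≠ 0 := z.2
        simp [smul_smul, this]
    _ = _ := by
        rw [lintegral_prod _ hg.aemeasurable]
        refine lintegral_congr fun y ↦ ?_
        rw [Measure.volumeIoiPow, lintegral_withDensity_eq_lintegral_mul _ hpow (by fun_prop)]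
        exact lintegral_subtype_comap measurableSet_Ioi
          fun r : ℝ ↦ ENNReal.ofReal (r ^ (finrank ℝ E - 1)) * f (r • (y : E))

theorem lintegral_pow_mul_exp_neg_mul (n : ℕ) {c : ℝ} (hc : 0 < c) :
    ∫⁻ r in Ioi (0 : ℝ), ENNReal.ofReal (r ^ n) * ENNReal.ofReal (exp (-(c * r))) =
      ENNReal.ofReal (n.factorial / c ^ (n + 1)) := by
  have key : ∫ r in Ioi (0 : ℝ), r ^ n * exp (-(c * r)) = n.factorial / c ^ (n + 1) := by
    have h := integral_rpow_mul_exp_neg_mul_Ioi (a := n + 1) (by positivity) hc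
    rw [Gamma_nat_eq_factorial, add_sub_cancel_right] at h
    norm_cast at h
    simpa [div_eq_inv_mul] using h
  rw [← key, ofReal_integral_eq_lintegral_ofReal]
  · refine setLIntegral_congr_fun measurableSet_Ioi fun r (hr : 0 < r) ↦ ?_
    exact (ENNReal.ofReal_mul (by positivity)).symm
  · by_contra h
    rw [integral_undef h] at key
    have : 0 < n.factorial / c ^ (n + 1) := by positivity
    exact this.ne key
  · filter_upwards [ae_restrict_mem measurableSet_Ioi] with r (hr : 0 < r)
    positivity

theorem lintegral_exp_neg_norm_sub_norm_smul [Nontrivial E] {x : E} (hx : ‖x‖ < 1) :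
    ∫⁻ z, ENNReal.ofReal (exp (-‖z - ‖z‖ • x‖)) ∂μ =
      ∫⁻ y : sphere (0 : E) 1,
        ENNReal.ofReal ((finrank ℝ E - 1).factorial / ‖(y : E) - x‖ ^ finrank ℝ E)
          ∂μ.toSphere := by
  rw [lintegral_eq_lintegral_toSphere μ (by fun_prop)]
  refine lintegral_congr fun y ↦ ?_
  have hy : ‖(y : E)‖ = 1 := norm_eq_of_mem_sphere y
  have hc : 0 < ‖(y : E) - x‖ := by
    have := norm_sub_norm_le (y : E) x
    linarith
  have h := lintegral_pow_mul_exp_neg_mul (finrank ℝ E - 1) hc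
  rw [Nat.sub_add_cancel finrank_pos] at h
  rw [← h]
  refine setLIntegral_congr_fun measurableSet_Ioi fun r (hr : 0 < r) ↦ ?_
  have : r • (y : E) - ‖r • (y : E)‖ • x = r • ((y : E) - x) := by
    rw [norm_smul, hy, mul_one, norm_of_nonneg hr.le, smul_sub]
  rw [this, norm_smul, norm_of_nonneg hr.le, mul_comm r]

end Polar

variable {E : Type*} [NormedAddCommGroup E] [InnerProductSpace ℝ E]

theorem injective_sub_norm_smul {x : E} (hx : ‖x‖ < 1) :
    Function.Injective fun z : E ↦ z - ‖z‖ • x := by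
  intro z z' h
  have h1 : z - z' = (‖z‖ - ‖z'‖) • x := by
    rw [← sub_eq_zero] at h ⊢
    rw [← h]
    module
  have h2 : ‖z - z'‖ ≤ ‖z - z'‖ * ‖x‖ := by
    conv_lhs => rw [h1, norm_smul]
    exact mul_le_mul_of_nonneg_right (abs_norm_sub_norm_le z z') (norm_nonneg x)
  rw [← sub_eq_zero, ← norm_eq_zero]
  nlinarith [norm_nonneg (z - z')]

theorem hasFDerivAt_sub_norm_smul (x : E) {z : E} (hz : z ≠ 0) :
    HasFDerivAt (fun z : E ↦ z - ‖z‖ • x)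
      (ContinuousLinearMap.id ℝ E - (‖z‖⁻¹ • innerSL ℝ z).smulRight x) z := by
  refine (hasFDerivAt_id z).sub (HasFDerivAt.smul_const ?_ x)
  have hz' : ‖z‖ ^ 2 ≠ 0 := by positivity
  have h := (hasStrictFDerivAt_norm_sq z).hasFDerivAt.sqrt hz'
  simp only [sqrt_sq (norm_nonneg _)] at h
  convert! h using 1
  rw [ofNat_smul_eq_nsmul, ← Nat.cast_smul_eq_nsmul ℝ, smul_smul]
  congr 1
  field_simp
  norm_num

theorem det_fderiv_sub_norm_smul [FiniteDimensional ℝ E] (x z : E) :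
    (ContinuousLinearMap.id ℝ E - (‖z‖⁻¹ • innerSL ℝ z).smulRight x).det =
      1 - ‖z‖⁻¹ * ⟪z, x⟫ := by
  have h := LinearMap.transvection.det (R := ℝ) (V := E)
    (‖z‖⁻¹ • innerSL ℝ z : E →L[ℝ] ℝ).toLinearMap (-x)
  rw [ContinuousLinearMap.det]
  convert! h using 1
  · congr 1
    ext w
    simp [LinearMap.transvection.apply, sub_eq_add_neg]
  · simp [sub_eq_add_neg]

/-- The discriminant governing the intersection with the unit sphere of the line through `x`
in direction `w`. -/
noncomputable def discr (x w : E) : ℝ := ⟪w, x⟫ ^ 2 + (1 - ‖x‖ ^ 2) * ‖w‖ ^ 2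

theorem discr_pos {x : E} (hx : ‖x‖ < 1) {w : E} (hw : w ≠ 0) : 0 < discr x w := by
  have h1 : 0 < 1 - ‖x‖ ^ 2 := by nlinarith [norm_nonneg x]
  have h2 : 0 < ‖w‖ := norm_pos_iff.2 hw
  unfold discr
  positivity

theorem abs_inner_le_sqrt_discr {x : E} (hx : ‖x‖ < 1) (w : E) :
    |⟪w, x⟫| ≤ √(discr x w) := by
  have h1 : 0 < 1 - ‖x‖ ^ 2 := by nlinarith [norm_nonneg x]
  refine abs_le_sqrt ?_
  unfold discr
  nlinarith [mul_nonneg h1.le (sq_nonneg ‖w‖)]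

theorem inner_lt_norm {x : E} (hx : ‖x‖ < 1) {z : E} (hz : z ≠ 0) : ⟪z, x⟫ < ‖z‖ := by
  have h2 : 0 < ‖z‖ := norm_pos_iff.2 hz
  have := real_inner_le_norm z x
  nlinarith

theorem inner_sub_norm_smul (x z : E) : ⟪z - ‖z‖ • x, x⟫ = ⟪z, x⟫ - ‖z‖ * ‖x‖ ^ 2 := by
  rw [inner_sub_left, real_inner_smul_left, real_inner_self_eq_norm_sq]

theorem sqrt_discr_sub_norm_smul {x : E} (hx : ‖x‖ < 1) {z : E} (hz : z ≠ 0) :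
    √(discr x (z - ‖z‖ • x)) = ‖z‖ - ⟪z, x⟫ := by
  rw [sqrt_eq_iff_mul_self_eq_of_pos (sub_pos.2 (inner_lt_norm hx hz)), discr,
    inner_sub_norm_smul, norm_sub_sq_real, real_inner_smul_right, norm_smul, norm_norm]
  ring

theorem image_sub_norm_smul {x : E} (hx : ‖x‖ < 1) :
    (fun z : E ↦ z - ‖z‖ • x) '' {0}ᶜ = {0}ᶜ := by
  have h1 : 0 < 1 - ‖x‖ ^ 2 := by nlinarith [norm_nonneg x]
  apply Subset.antisymm
  · rintro _ ⟨z, hz, rfl⟩ h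
    refine hz (injective_sub_norm_smul hx ?_)
    simpa using h
  · intro w hw
    set ρ : ℝ := (⟪w, x⟫ + √(discr x w)) / (1 - ‖x‖ ^ 2) with hρ
    have hρ0 : 0 ≤ ρ := by
      have := neg_le_of_abs_le (abs_inner_le_sqrt_discr hx w)
      exact div_nonneg (by linarith) h1.le
    have hs : √(discr x w) = (1 - ‖x‖ ^ 2) * ρ - ⟪w, x⟫ := by
      rw [hρ]; field_simp; ring
    have hsq := sq_sqrt (discr_pos hx hw).le
    rw [hs, discr] at hsq
    have hq : ‖w‖ ^ 2 + 2 * (ρ * ⟪w, x⟫) + ρ ^ 2 * ‖x‖ ^ 2 = ρ ^ 2 := by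
      apply mul_left_cancel₀ h1.ne'
      linear_combination -hsq
    have hnorm : ‖w + ρ • x‖ = ρ := by
      rw [← sq_eq_sq₀ (norm_nonneg _) hρ0, norm_add_sq_real, real_inner_smul_right, norm_smul,
        norm_of_nonneg hρ0, mul_pow, hq]
    refine ⟨w + ρ • x, fun h ↦ hw ?_, by simp [hnorm]⟩
    have h0 : w + ρ • x = 0 := h
    rw [h0, norm_zero] at hnorm
    simpa [← hnorm] using h0

variable [FiniteDimensional ℝ E] [MeasurableSpace E] [BorelSpace E] (μ : Measure E)
  [μ.IsAddHaarMeasure]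

/-- The odd part of the weight `1 + ⟪w, x⟫ / √(discr x w)` does not contribute. -/
theorem lintegral_exp_neg_norm_mul_one_add {x : E} (hx : ‖x‖ < 1) :
    ∫⁻ w, ENNReal.ofReal (exp (-‖w‖) * (1 + ⟪w, x⟫ / √(discr x w))) ∂μ =
      ∫⁻ w, ENNReal.ofReal (exp (-‖w‖)) ∂μ := by
  have hd : Measurable fun w ↦ discr x w := by unfold discr; fun_prop
  have hle (w : E) : |⟪w, x⟫ / √(discr x w)| ≤ 1 := by
    rw [abs_div, abs_of_nonneg (sqrt_nonneg _)]
    exact div_le_one_of_le₀ (abs_inner_le_sqrt_discr hx w) (sqrt_nonneg _)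
  have hneg : ∫⁻ w, ENNReal.ofReal (exp (-‖w‖) * (1 + ⟪w, x⟫ / √(discr x w))) ∂μ =
      ∫⁻ w, ENNReal.ofReal (exp (-‖w‖) * (1 - ⟪w, x⟫ / √(discr x w))) ∂μ := by
    rw [← lintegral_neg_eq_self]
    simp [discr, neg_div, sub_eq_add_neg]
  refine (ENNReal.mul_right_inj two_ne_zero ENNReal.ofNat_ne_top).1 ?_
  rw [two_mul]
  nth_rewrite 2 [hneg]
  rw [← lintegral_add_left (by fun_prop), ← lintegral_const_mul _ (by fun_prop)]
  refine lintegral_congr fun w ↦ ?_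
  have := abs_le.1 (hle w)
  rw [← ENNReal.ofReal_add (mul_nonneg (exp_nonneg _) (by linarith))
    (mul_nonneg (exp_nonneg _) (by linarith)), ← ENNReal.ofReal_ofNat,
    ← ENNReal.ofReal_mul two_pos.le]
  ring_nf

theorem ofReal_mul_lintegral_exp_neg_norm_sub_norm_smul [Nontrivial E] {x : E} (hx : ‖x‖ < 1) :
    ENNReal.ofReal (1 - ‖x‖ ^ 2) * ∫⁻ z, ENNReal.ofReal (exp (-‖z - ‖z‖ • x‖)) ∂μ =
      ∫⁻ w, ENNReal.ofReal (exp (-‖w‖)) ∂μ := by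
  have hm : MeasurableSet ({0}ᶜ : Set E) := (measurableSet_singleton _).compl
  have hcov := lintegral_image_eq_lintegral_abs_det_fderiv_mul μ hm
    (fun z hz ↦ (hasFDerivAt_sub_norm_smul x hz).hasFDerivWithinAt)
    (injective_sub_norm_smul hx).injOn
    (fun w ↦ ENNReal.ofReal (exp (-‖w‖) * (1 + ⟪w, x⟫ / √(discr x w))))
  rw [image_sub_norm_smul hx, restrict_compl_singleton,
    lintegral_exp_neg_norm_mul_one_add μ hx] at hcov
  rw [hcov, ← lintegral_const_mul _ (by fun_prop), ← restrict_compl_singleton (μ := μ) 0]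
  refine setLIntegral_congr_fun hm fun z hz ↦ ?_
  have h2 : 0 < ‖z‖ := norm_pos_iff.2 hz
  have h3 := sub_pos.2 (inner_lt_norm hx hz)
  have h4 : 1 - ‖z‖⁻¹ * ⟪z, x⟫ = (‖z‖ - ⟪z, x⟫) / ‖z‖ := by field_simp
  have h1 : 0 < 1 - ‖x‖ ^ 2 := by nlinarith [norm_nonneg x]
  simp only [det_fderiv_sub_norm_smul, sqrt_discr_sub_norm_smul hx hz, inner_sub_norm_smul]
  rw [h4, abs_of_pos (by positivity), ← ENNReal.ofReal_mul h1.le,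
    ← ENNReal.ofReal_mul (by positivity)]
  congr 1
  field_simp
  ring

/-- The Poisson kernel of the unit ball has total mass equal to that of the unit sphere. -/
theorem lintegral_poissonKernel_toSphere [Nontrivial E] {x : E} (hx : ‖x‖ < 1) :
    ∫⁻ y : sphere (0 : E) 1,
      ENNReal.ofReal ((1 - ‖x‖ ^ 2) / ‖(y : E) - x‖ ^ finrank ℝ E) ∂μ.toSphere =
      μ.toSphere univ := by
  have h1 : 0 < 1 - ‖x‖ ^ 2 := by nlinarith [norm_nonneg x]
  set N : ℝ := ((finrank ℝ E - 1).factorial : ℝ)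
  have hN : 0 < N := by positivity
  have h := ofReal_mul_lintegral_exp_neg_norm_sub_norm_smul μ hx
  have h0 := lintegral_exp_neg_norm_sub_norm_smul μ (x := (0 : E)) (by simp)
  simp only [smul_zero, sub_zero, norm_eq_of_mem_sphere, one_pow, div_one, lintegral_const] at h0
  rw [h0, lintegral_exp_neg_norm_sub_norm_smul μ hx, ← lintegral_const_mul _ (by fun_prop)] at h
  refine (ENNReal.mul_right_inj (ENNReal.ofReal_pos.2 hN).ne' ENNReal.ofReal_ne_top).1 ?_
  rw [← h, ← lintegral_const_mul _ (by fun_prop)]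
  refine lintegral_congr fun y ↦ ?_
  rw [← ENNReal.ofReal_mul hN.le, ← ENNReal.ofReal_mul h1.le]
  congr 1
  ring

end PoissonKernel

theorem stmt_17 (n : ℕ) (x : EuclideanSpace ℝ (Fin (n+1))) (hx : ‖x‖ < 1)
    (σ : Measure (Metric.sphere (0 : EuclideanSpace ℝ (Fin (n+1))) 1))
    -- σ is the Haar (rotation-invariant) probability measure on the sphere,
    -- i.e. the normalized measure induced by the Lebesgue measure:
    (hσ : σ = ((volume : Measure (EuclideanSpace ℝ (Fin (n+1)))).toSphere
        Set.univ)⁻¹ • (volume : Measure (EuclideanSpace ℝ (Fin (n+1)))).toSphere) :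
    ∫ y : Metric.sphere (0 : EuclideanSpace ℝ (Fin (n+1))) 1,
      (1 - ‖x‖^2) / ‖(y : EuclideanSpace ℝ (Fin (n+1))) - x‖ ^ (n + 1) ∂σ = 1 := by
  have h1 : 0 < 1 - ‖x‖ ^ 2 := by nlinarith [norm_nonneg x]
  have h := PoissonKernel.lintegral_poissonKernel_toSphere
    (volume : Measure (EuclideanSpace ℝ (Fin (n+1)))) hx
  rw [finrank_euclideanSpace_fin] at h
  have hm : Measurable fun y : Metric.sphere (0 : EuclideanSpace ℝ (Fin (n+1))) 1 ↦
      (1 - ‖x‖^2) / ‖(y : EuclideanSpace ℝ (Fin (n+1))) - x‖ ^ (n + 1) := by fun_prop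
  rw [integral_eq_lintegral_of_nonneg_ae (.of_forall fun y ↦ by positivity)
    hm.aestronglyMeasurable, hσ, lintegral_smul_measure, h, smul_eq_mul,
    ENNReal.inv_mul_cancel (Measure.measure_univ_ne_zero.2 (Measure.toSphere_ne_zero _))
      (measure_ne_top _ _), ENNReal.toReal_one]
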